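/- For a convex body K in ℝⁿ, the minimum over the unit sphere of the width function w_K equals the minimum of the directional diameter function d_K (this common value is the thickness ω_K of K). -/

import Mathlib

open scoped RealInnerProductSpace
open Metric Filter

/-- Width of `K` in direction `u`: distance between the two supporting
hyperplanes of `K` orthogonal to the unit vector `u`. -/
noncomputable def widthFn {n : ℕ} (K : Set (EuclideanSpace ℝ (Fin n)))
    (u : EuclideanSpace ℝ (Fin n)) : ℝ :=
  sSup ((fun x => ⟪x, u⟫) '' K) - sInf ((fun x => ⟪x, u⟫) '' K)

/-- Diameter of `K` in direction `u`: maximal length of a chord of `K` parallel to `u`. -/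
noncomputable def dirDiam {n : ℕ} (K : Set (EuclideanSpace ℝ (Fin n)))
    (u : EuclideanSpace ℝ (Fin n)) : ℝ :=
  sSup {d : ℝ | ∃ x ∈ K, ∃ y ∈ K, (∃ t : ℝ, x - y = t • u) ∧ d = dist x y}

/-- Projective spherical distance `ρ(u,v) = arccos |⟨u,v⟩|`. -/
noncomputable def rho {n : ℕ} (u v : EuclideanSpace ℝ (Fin n)) : ℝ :=
  Real.arccos |⟪u, v⟫|

/-- `e_K(O)`: maximal length of a chord of `K` cut by a line through `O`. -/
noncomputable def eFn {n : ℕ} (K : Set (EuclideanSpace ℝ (Fin n)))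
    (O : EuclideanSpace ℝ (Fin n)) : ℝ :=
  sSup {d : ℝ | ∃ x ∈ K, ∃ y ∈ K, Collinear ℝ ({O, x, y} : Set (EuclideanSpace ℝ (Fin n))) ∧
    d = dist x y}

/-- `s_K(u)`: maximal distance between a point of `K` in one supporting hyperplane
orthogonal to `u` and a point of `K` in the other. -/
noncomputable def sFn {n : ℕ} (K : Set (EuclideanSpace ℝ (Fin n)))
    (u : EuclideanSpace ℝ (Fin n)) : ℝ :=
  sSup {d : ℝ | ∃ A ∈ K, ∃ B ∈ K,
    (∀ x ∈ K, ⟪x, u⟫ ≤ ⟪A, u⟫) ∧ (∀ x ∈ K, ⟪B, u⟫ ≤ ⟪x, u⟫) ∧ d = dist A B}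

/-- `r_K(u)`: infimum over diametral chords `[AB]` for `u` and pairs of parallel
supporting hyperplanes `H₁ ∋ A`, `H₂ ∋ B` of the distance between `H₁` and `H₂`. -/
noncomputable def rFn {n : ℕ} (K : Set (EuclideanSpace ℝ (Fin n)))
    (u : EuclideanSpace ℝ (Fin n)) : ℝ :=
  sInf {d : ℝ | ∃ A ∈ K, ∃ B ∈ K, (∃ t : ℝ, A - B = t • u) ∧ dist A B = dirDiam K u ∧
    ∃ v : EuclideanSpace ℝ (Fin n), ‖v‖ = 1 ∧
      (∀ x ∈ K, ⟪x, v⟫ ≤ ⟪A, v⟫) ∧ (∀ x ∈ K, ⟪B, v⟫ ≤ ⟪x, v⟫) ∧ d = ⟪A - B, v⟫}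

lemma width_attained {n : ℕ} (K : Set (EuclideanSpace ℝ (Fin n))) (hKc : IsCompact K)
    (hne : K.Nonempty) (u : EuclideanSpace ℝ (Fin n)) :
    ∃ x ∈ K, ∃ y ∈ K, widthFn K u = ⟪x - y, u⟫ := by
  have hc : IsCompact ((fun x => ⟪x, u⟫) '' K) :=
    hKc.image (by fun_prop)
  have hn := hne.image (fun x => ⟪x, u⟫)
  obtain ⟨x, hx, hxe⟩ := hc.sSup_mem hn
  obtain ⟨y, hy, hye⟩ := hc.sInf_mem hn
  refine ⟨x, hx, y, hy, ?_⟩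
  unfold widthFn
  rw [← hxe, ← hye, inner_sub_left]

lemma inner_le_width {n : ℕ} (K : Set (EuclideanSpace ℝ (Fin n))) (hKc : IsCompact K)
    (u x y : EuclideanSpace ℝ (Fin n)) (hx : x ∈ K) (hy : y ∈ K) :
    ⟪x - y, u⟫ ≤ widthFn K u := by
  have hc : IsCompact ((fun x => ⟪x, u⟫) '' K) :=
    hKc.image (by fun_prop)
  have h1 := le_csSup hc.bddAbove (Set.mem_image_of_mem (fun x => ⟪x, u⟫) hx)
  have h2 := csInf_le hc.bddBelow (Set.mem_image_of_mem (fun x => ⟪x, u⟫) hy)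
  unfold widthFn
  rw [inner_sub_left]
  linarith

lemma width_nonneg {n : ℕ} (K : Set (EuclideanSpace ℝ (Fin n))) (hKc : IsCompact K)
    (hne : K.Nonempty) (u : EuclideanSpace ℝ (Fin n)) : 0 ≤ widthFn K u := by
  obtain ⟨x, hx⟩ := hne
  simpa using inner_le_width K hKc u x x hx hx

lemma chord_le_width {n : ℕ} (K : Set (EuclideanSpace ℝ (Fin n))) (hKc : IsCompact K)
    (u : EuclideanSpace ℝ (Fin n)) (hu : ‖u‖ = 1) (d : ℝ)
    (hd : ∃ x ∈ K, ∃ y ∈ K, (∃ t : ℝ, x - y = t • u) ∧ d = dist x y) :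
    d ≤ widthFn K u := by
  obtain ⟨x, hx, y, hy, ⟨t, ht⟩, rfl⟩ := hd
  have h1 := inner_le_width K hKc u x y hx hy
  have h2 := inner_le_width K hKc u y x hy hx
  have e : ⟪x - y, u⟫ = t := by
    rw [ht, inner_smul_left, real_inner_self_eq_norm_sq, hu]; simp
  have e2 : ⟪y - x, u⟫ = -t := by
    rw [← neg_sub x y, inner_neg_left, e]
  rw [dist_eq_norm, ht, norm_smul, hu, mul_one, Real.norm_eq_abs]
  exact abs_le'.2 ⟨by linarith, by linarith⟩

lemma mem_sub_of_le_width {n : ℕ} (K : Set (EuclideanSpace ℝ (Fin n))) (hKc : IsCompact K)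
    (hKconv : Convex ℝ K) (hne : K.Nonempty) (c : ℝ)
    (hc : ∀ v : EuclideanSpace ℝ (Fin n), ‖v‖ = 1 → c ≤ widthFn K v)
    (z : EuclideanSpace ℝ (Fin n)) (hz : ‖z‖ ≤ c) : ∃ x ∈ K, ∃ y ∈ K, x - y = z := by
  by_contra hcon
  have hD : IsCompact ((fun p : EuclideanSpace ℝ (Fin n) × EuclideanSpace ℝ (Fin n) =>
      p.1 - p.2) '' (K ×ˢ K)) := (hKc.prod hKc).image (by fun_prop)
  have hDc : Convex ℝ ((fun p : EuclideanSpace ℝ (Fin n) × EuclideanSpace ℝ (Fin n) =>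
      p.1 - p.2) '' (K ×ˢ K)) :=
    (hKconv.prod hKconv).is_linear_image IsLinearMap.isLinearMap_sub
  have hzD : z ∉ ((fun p : EuclideanSpace ℝ (Fin n) × EuclideanSpace ℝ (Fin n) =>
      p.1 - p.2) '' (K ×ˢ K)) := by
    rintro ⟨⟨x, y⟩, ⟨hx, hy⟩, h⟩
    exact hcon ⟨x, hx, y, hy, h⟩
  obtain ⟨f, r, hf, hr⟩ := geometric_hahn_banach_closed_point hDc hD.isClosed hzD
  have key : ∀ x ∈ K, ∀ y ∈ K, f (x - y) < f z := fun x hx y hy =>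
    (hf _ ⟨(x, y), ⟨hx, hy⟩, rfl⟩).trans hr
  set v := (InnerProductSpace.toDual ℝ (EuclideanSpace ℝ (Fin n))).symm f with hv
  have hfv : ∀ w, f w = ⟪w, v⟫ := fun w => by
    rw [real_inner_comm, hv, InnerProductSpace.toDual_symm_apply]
  have hv0 : v ≠ 0 := by
    intro h
    obtain ⟨x, hx⟩ := hne
    have := key x hx x hx
    simp [hfv, h] at this
  have hvn : 0 < ‖v‖ := norm_pos_iff.2 hv0
  obtain ⟨x, hx, y, hy, hw⟩ := width_attained K hKc hne (‖v‖⁻¹ • v)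
  have h1 := hc (‖v‖⁻¹ • v) (norm_smul_inv_norm hv0)
  have h2 := key x hx y hy
  rw [hfv, hfv] at h2
  have h3 := real_inner_le_norm z v
  rw [hw, inner_smul_right, inv_mul_eq_div, le_div_iff₀ hvn] at h1
  nlinarith

theorem min_width_eq_min_dirDiam {n : ℕ} (hn : 2 ≤ n)
    (K : Set (EuclideanSpace ℝ (Fin n)))
    (hKc : IsCompact K) (hKconv : Convex ℝ K) (hKint : (interior K).Nonempty) :
    (⨅ u : sphere (0 : EuclideanSpace ℝ (Fin n)) 1, widthFn K u) =
      ⨅ u : sphere (0 : EuclideanSpace ℝ (Fin n)) 1, dirDiam K u := by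
  have hne : K.Nonempty := hKint.mono interior_subset
  have : Nonempty (sphere (0 : EuclideanSpace ℝ (Fin n)) 1) :=
    ⟨⟨EuclideanSpace.single ⟨0, by omega⟩ 1, by simp⟩⟩
  have hbw : BddBelow (Set.range fun u : sphere (0 : EuclideanSpace ℝ (Fin n)) 1 =>
      widthFn K u) := ⟨0, by rintro _ ⟨u, rfl⟩; exact width_nonneg K hKc hne u⟩
  have hbd : BddBelow (Set.range fun u : sphere (0 : EuclideanSpace ℝ (Fin n)) 1 =>
      dirDiam K u) := ⟨0, by
        rintro _ ⟨u, rfl⟩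
        apply Real.sSup_nonneg
        rintro _ ⟨x, _, y, _, _, rfl⟩
        exact dist_nonneg⟩
  have hw0 : 0 ≤ ⨅ u : sphere (0 : EuclideanSpace ℝ (Fin n)) 1, widthFn K u :=
    le_ciInf fun u => width_nonneg K hKc hne u
  apply le_antisymm
  · refine le_ciInf fun u => ?_
    have hu : ‖(u : EuclideanSpace ℝ (Fin n))‖ = 1 := by simp
    set c := ⨅ u : sphere (0 : EuclideanSpace ℝ (Fin n)) 1, widthFn K u with hcdef
    have hcu : ‖c • (u : EuclideanSpace ℝ (Fin n))‖ = c := by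
      rw [norm_smul, hu, mul_one, Real.norm_of_nonneg hw0]
    obtain ⟨x, hx, y, hy, hxy⟩ := mem_sub_of_le_width K hKc hKconv hne c
      (fun v hv => ciInf_le hbw ⟨v, by simpa using hv⟩) (c • (u : EuclideanSpace ℝ (Fin n)))
      hcu.le
    refine le_csSup ⟨widthFn K u, fun d hd => chord_le_width K hKc u hu d hd⟩ ?_
    exact ⟨x, hx, y, hy, ⟨c, hxy⟩, by rw [dist_eq_norm, hxy, hcu]⟩
  · refine le_ciInf fun u => (ciInf_le hbd u).trans ?_
    have hu : ‖(u : EuclideanSpace ℝ (Fin n))‖ = 1 := by simp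
    obtain ⟨x, hx⟩ := hne
    exact csSup_le ⟨0, x, hx, x, hx, ⟨0, by simp⟩, by simp⟩
      fun d hd => chord_le_width K hKc u hu d hd
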